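/- Let the symmetric group S_m act on sets R of permutations of [m] by σ·R = {(σ(i_1)⋯σ(i_m)) : (i_1⋯i_m) ∈ R}, and call two ranking patterns equivalent if one is obtained from the other by this action. Then the number of equivalence classes of the set {RP^UF(μ_1,…,μ_m) : μ_1,…,μ_m ∈ ℝ^{m−2} generic} (the number of inequivalent ranking patterns of unfolding models of codimension one) equals 1 when m = 3 and equals 3 when m = 4. -/

import Mathlib

open scoped BigOperators

/-- The chamber `C_{i₁⋯i_m}` of the braid arrangement restricted to
`H0 = {x : ∑ᵢ xᵢ = 0}`, associated with the permutation `σ` (where `σ k` is the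
object ranked in position `k`). -/
def braidChamber {m : ℕ} (σ : Equiv.Perm (Fin m)) :
    Set (EuclideanSpace ℝ (Fin m)) :=
  {x | (∑ i, x i = 0) ∧ ∀ k l : Fin m, k < l → x (σ l) < x (σ k)}

/-- The slicing hyperplane `K_v = {x ∈ H0 : vᵀ x = 1}`. -/
def sliceK {m : ℕ} (v : EuclideanSpace ℝ (Fin m)) :
    Set (EuclideanSpace ℝ (Fin m)) :=
  {x | (∑ i, x i = 0) ∧ ∑ i, v i * x i = 1}

/-- The set `V` of generic unit directions: `v ∈ H0`, `‖v‖ = 1`, and all sums of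
entries of `v` over nonempty proper subsets of `[m]` are nonzero. -/
def genericDirections (m : ℕ) : Set (EuclideanSpace ℝ (Fin m)) :=
  {v | (∑ i, v i = 0) ∧ ‖v‖ = 1 ∧
    ∀ I : Finset (Fin m), I.Nonempty → I ≠ Finset.univ → ∑ i ∈ I, v i ≠ 0}

/-- Condition (A) for `m` points in a real vector space, with `N` edges. -/
def ConditionA {m : ℕ} (N : ℕ) {E : Type*} [AddCommGroup E] [Module ℝ E]
    (ν : Fin m → E) : Prop :=
  ∀ e : Fin N → Fin m × Fin m,
    (∀ k, (e k).1 ≠ (e k).2) →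
    Function.Injective (fun k => s((e k).1, (e k).2)) →
    ((SimpleGraph.fromEdgeSet
        (Set.range fun k => s((e k).1, (e k).2))).IsAcyclic ↔
      LinearIndependent ℝ fun k => ν (e k).1 - ν (e k).2)

/-- Genericity of `μ₁,…,μ_m ∈ ℝ^{m-2}` : condition (A1) and condition (A2) for
the lifted points `(μⱼ, ‖μⱼ‖²)`. -/
def Generic {m : ℕ} (μ : Fin m → EuclideanSpace ℝ (Fin (m - 2))) : Prop :=
  ConditionA (m - 2) μ ∧
    ConditionA (m - 1)
      (fun j => (μ j, ‖μ j‖ ^ 2) :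
        Fin m → EuclideanSpace ℝ (Fin (m - 2)) × ℝ)

/-- The ranking pattern of the braid slice by `K_v`. -/
def rankingPattern {m : ℕ} (v : EuclideanSpace ℝ (Fin m)) :
    Set (Equiv.Perm (Fin m)) :=
  {σ | (sliceK v ∩ braidChamber σ).Nonempty}

/-- The ranking pattern of the unfolding model with ideal objects `μ₁,…,μ_m`. -/
def rankingPatternUF {m n : ℕ} (μ : Fin m → EuclideanSpace ℝ (Fin n)) :
    Set (Equiv.Perm (Fin m)) :=
  {σ | ∃ y : EuclideanSpace ℝ (Fin n),
    ∀ k l : Fin m, k < l → ‖y - μ (σ k)‖ < ‖y - μ (σ l)‖}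

/-- Two ranking patterns are equivalent iff one is obtained from the other by
relabelling the objects: `σ·R = {(σ(i₁)⋯σ(i_m)) : (i₁⋯i_m) ∈ R}`. -/
def patternEquiv {m : ℕ} (R R' : Set (Equiv.Perm (Fin m))) : Prop :=
  ∃ σ : Equiv.Perm (Fin m), R = (fun τ => σ * τ) '' R'

/-- The set of ranking patterns of unfolding models of codimension one. -/
def rankingPatternsUF (m : ℕ) : Set (Set (Equiv.Perm (Fin m))) :=
  {R | ∃ μ : Fin m → EuclideanSpace ℝ (Fin (m - 2)),
    Generic μ ∧ R = rankingPatternUF μ}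

/-- The permutations `σ` along which some initial partial sum of `v` is positive. -/
def signPattern {m : ℕ} {K : Type*} [AddCommMonoid K] [LT K] (v : Fin m → K) :
    Set (Equiv.Perm (Fin m)) :=
  {σ | ∃ k, 0 < ∑ j, if j ≤ k then v (σ j) else 0}

/-- Summation by parts: if all partial sums of `f` are nonpositive and `z` is antitone, then
`∑ f z` is at most `∑ f` times the last value of `z`. -/
lemma sum_mul_le_of_partial_sums_nonpos :
    ∀ {n : ℕ} {f z : Fin (n + 1) → ℝ}, Antitone z →
      (∀ k, ∑ j, (if j ≤ k then f j else 0) ≤ 0) →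
      ∑ j, f j * z j ≤ (∑ j, f j) * z (Fin.last n)
  | 0, f, z, _, _ => by simp
  | n + 1, f, z, hz, hf => by
    have hcast : ∀ k : Fin (n + 1), ∑ j : Fin (n + 1), (if j ≤ k then f j.castSucc else 0) ≤ 0 := by
      intro k
      have h := hf k.castSucc
      rw [Fin.sum_univ_castSucc] at h
      simpa [Fin.last_le_iff, (Fin.castSucc_lt_last k).ne] using h
    have ih := sum_mul_le_of_partial_sums_nonpos (f := fun j => f j.castSucc)
      (z := fun j => z j.castSucc) (fun a b hab => hz (by simpa using hab)) hcast
    have hsum : ∑ j : Fin (n + 1), f j.castSucc ≤ 0 := by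
      simpa [Fin.le_last] using hcast (Fin.last n)
    have hzl : z (Fin.last (n + 1)) ≤ z (Fin.last n).castSucc := hz (Fin.le_last _)
    rw [Fin.sum_univ_castSucc, Fin.sum_univ_castSucc (f := f), add_mul]
    have := mul_le_mul_of_nonpos_left hzl hsum
    linarith

/-- A chamber meets the open half-space `v · z > 0` iff some initial partial sum is positive. -/
lemma mem_signPattern_of_strictAnti {m : ℕ} {v z : Fin m → ℝ} {σ : Equiv.Perm (Fin m)}
    (hv : ∑ i, v i = 0) (hz : StrictAnti (z ∘ σ)) (hpos : 0 < ∑ i, v i * z i) :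
    σ ∈ signPattern v := by
  by_contra hσ
  simp only [signPattern, Set.mem_ofPred_eq, not_exists, not_lt] at hσ
  obtain _ | n := m
  · simp at hpos
  have h := sum_mul_le_of_partial_sums_nonpos (f := v ∘ σ) hz.antitone hσ
  simp only [Function.comp_apply] at h
  rw [Equiv.sum_comp σ v, Equiv.sum_comp σ (fun i => v i * z i), hv] at h
  linarith

lemma exists_strictAnti_of_mem_signPattern {m : ℕ} {v : Fin m → ℝ} {σ : Equiv.Perm (Fin m)}
    (hσ : σ ∈ signPattern v) {c : ℝ} (hc : 0 < c) :
    ∃ z : Fin m → ℝ, StrictAnti (z ∘ σ) ∧ ∑ i, v i * z i = c := by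
  obtain ⟨k, hk⟩ := hσ
  set S := ∑ j, if j ≤ k then v (σ j) else 0 with hS
  set T := ∑ j, v (σ j) * ((j : ℕ) : ℝ) with hT
  set M := |T| / S + 1 with hM
  have hM0 : 0 ≤ M := by positivity
  have hpos : 0 < M * S - T := by
    have : M * S = |T| + S := by rw [hM]; field_simp
    linarith [le_abs_self T]
  refine ⟨fun i => c / (M * S - T) *
    ((if σ.symm i ≤ k then M else 0) - ((σ.symm i : ℕ) : ℝ)), ?_, ?_⟩
  · intro a b hab
    simp only [Function.comp_apply, Equiv.symm_apply_apply]
    apply mul_lt_mul_of_pos_left _ (div_pos hc hpos)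
    have hlt : ((a : ℕ) : ℝ) < ((b : ℕ) : ℝ) := by exact_mod_cast hab
    split_ifs with h1 h2
    · linarith
    · exact absurd (hab.le.trans h1) h2
    · linarith
    · linarith
  · rw [← Equiv.sum_comp σ]
    simp only [Equiv.symm_apply_apply]
    have : ∀ j, v (σ j) * (c / (M * S - T) * ((if j ≤ k then M else 0) - ((j : ℕ) : ℝ))) =
        c / (M * S - T) *
          (M * (if j ≤ k then v (σ j) else 0) - v (σ j) * ((j : ℕ) : ℝ)) := by
      intro j; split_ifs <;> ring
    rw [Finset.sum_congr rfl fun j _ => this j, ← Finset.mul_sum, Finset.sum_sub_distrib,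
      ← Finset.mul_sum, ← hS, ← hT]
    field_simp

/-- If `v` spans the affine dependencies of `μ`, oriented so that `∑ vᵢ ‖μᵢ‖² < 0`, then the
ranking pattern of `μ` is the sign pattern of `v`. -/
lemma rankingPatternUF_eq_signPattern {m n : ℕ} {μ : Fin m → EuclideanSpace ℝ (Fin n)}
    {v : Fin m → ℝ} (hv : ∑ i, v i = 0) (hμ : ∑ i, v i • μ i = 0)
    (hneg : ∑ i, v i * ‖μ i‖ ^ 2 < 0)
    (hsolve : ∀ z : Fin m → ℝ, ∑ i, v i * z i = 0 →
      ∃ (y : EuclideanSpace ℝ (Fin n)) (t : ℝ), ∀ i, z i = inner ℝ y (μ i) + t) :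
    rankingPatternUF μ = signPattern v := by
  have hnorm : ∀ (y : EuclideanSpace ℝ (Fin n)) i,
      ‖y - μ i‖ ^ 2 = ‖y‖ ^ 2 - 2 * inner ℝ y (μ i) + ‖μ i‖ ^ 2 :=
    fun y i => norm_sub_sq_real y (μ i)
  ext σ
  constructor
  · rintro ⟨y, hy⟩
    refine mem_signPattern_of_strictAnti (z := fun i => -‖y - μ i‖ ^ 2) hv ?_ ?_
    · intro k l hkl
      have := hy k l hkl
      simp only [Function.comp_apply, neg_lt_neg_iff]
      gcongr
    · have hinner : ∑ i, v i * inner ℝ y (μ i) = 0 := by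
        simpa [inner_sum, inner_smul_right] using congrArg (fun u => inner ℝ y u) hμ
      have : ∑ i, v i * -‖y - μ i‖ ^ 2 = -‖y‖ ^ 2 * ∑ i, v i + 2 * ∑ i, v i * inner ℝ y (μ i)
          - ∑ i, v i * ‖μ i‖ ^ 2 := by
        simp only [Finset.mul_sum, ← Finset.sum_add_distrib, ← Finset.sum_sub_distrib]
        exact Finset.sum_congr rfl fun i _ => by rw [hnorm]; ring
      rw [this, hv, hinner]
      linarith
  · intro hσ
    obtain ⟨z, hz, hzc⟩ := exists_strictAnti_of_mem_signPattern hσ (neg_pos.2 hneg)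
    obtain ⟨y, t, hy⟩ := hsolve (fun i => (z i + ‖μ i‖ ^ 2) / 2) (by
      have : ∑ i, v i * ((z i + ‖μ i‖ ^ 2) / 2) =
          (∑ i, v i * z i + ∑ i, v i * ‖μ i‖ ^ 2) / 2 := by
        rw [← Finset.sum_add_distrib, Finset.sum_div]
        exact Finset.sum_congr rfl fun i _ => by ring
      rw [this, hzc]; ring)
    refine ⟨y, fun k l hkl => ?_⟩
    have h := hz hkl
    simp only [Function.comp_apply] at h
    refine lt_of_pow_lt_pow_left₀ 2 (norm_nonneg _) ?_
    rw [hnorm, hnorm]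
    have h1 := hy (σ k)
    have h2 := hy (σ l)
    linarith

/-- By convexity of `‖·‖²`, a dependency with `∑ vᵢ ‖μᵢ‖² < 0` has, away from any given index,
a negative coefficient. -/
lemma exists_ne_neg_of_sum_mul_norm_sq_neg {ι E : Type*} [Fintype ι] [NormedAddCommGroup E]
    [InnerProductSpace ℝ E] {μ : ι → E} {v : ι → ℝ} (hv : ∑ i, v i = 0)
    (hμ : ∑ i, v i • μ i = 0) (hneg : ∑ i, v i * ‖μ i‖ ^ 2 < 0) (j : ι) :
    ∃ i ≠ j, v i < 0 := by
  by_contra! h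
  have hinner : ∑ i, v i * inner ℝ (μ j) (μ i) = 0 := by
    simpa [inner_sum, inner_smul_right] using congrArg (fun u => inner ℝ (μ j) u) hμ
  have hexp : ∑ i, v i * ‖μ j - μ i‖ ^ 2 = ‖μ j‖ ^ 2 * ∑ i, v i
      - 2 * ∑ i, v i * inner ℝ (μ j) (μ i) + ∑ i, v i * ‖μ i‖ ^ 2 := by
    simp only [Finset.mul_sum, ← Finset.sum_add_distrib, ← Finset.sum_sub_distrib]
    exact Finset.sum_congr rfl fun i _ => by rw [norm_sub_sq_real]; ring
  have hnonneg : 0 ≤ ∑ i, v i * ‖μ j - μ i‖ ^ 2 := by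
    refine Finset.sum_nonneg fun i _ => ?_
    by_cases hi : i = j
    · simp [hi]
    · exact mul_nonneg (h i hi) (by positivity)
  rw [hexp, hv, hinner] at hnonneg
  linarith

lemma signPattern_congr {m : ℕ} {v w : Fin m → ℝ}
    (h : ∀ I : Finset (Fin m), 0 < ∑ i, (if i ∈ I then v i else 0) ↔
      0 < ∑ i, (if i ∈ I then w i else 0)) :
    signPattern v = signPattern w := by
  have key : ∀ (u : Fin m → ℝ) (σ : Equiv.Perm (Fin m)) (k : Fin m),
      (∑ j, if j ≤ k then u (σ j) else 0) =
        ∑ i, if i ∈ Finset.univ.filter (fun i => σ.symm i ≤ k) then u i else 0 := by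
    intro u σ k
    rw [← Equiv.sum_comp σ (fun i => if i ∈ _ then u i else 0)]
    simp
  ext σ
  simp only [signPattern, Set.mem_ofPred_eq, key, h]

lemma signPattern_intCast {m : ℕ} (w : Fin m → ℤ) :
    signPattern (fun i => (w i : ℝ)) = signPattern w := by
  ext σ
  refine exists_congr fun k => ?_
  rw [← Int.cast_pos (R := ℝ), Int.cast_sum]
  simp only [Int.cast_ite, Int.cast_zero]

lemma patternEquiv_signPattern_comp {m : ℕ} (v : Fin m → ℝ) (σ : Equiv.Perm (Fin m)) :
    patternEquiv (signPattern v) (signPattern (v ∘ σ)) := by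
  refine ⟨σ, Set.ext fun τ => ⟨fun h => ⟨σ⁻¹ * τ, ?_, by simp⟩, ?_⟩⟩
  · simpa [signPattern] using h
  · rintro ⟨ρ, hρ, rfl⟩
    simpa [signPattern] using hρ

lemma patternEquiv_equivalence (m : ℕ) : Equivalence (patternEquiv (m := m)) where
  refl R := ⟨1, by simp⟩
  symm := by
    rintro R R' ⟨σ, rfl⟩
    exact ⟨σ⁻¹, by rw [Set.image_image]; simp⟩
  trans := by
    rintro R R' R'' ⟨σ, rfl⟩ ⟨τ, rfl⟩
    exact ⟨σ * τ, by rw [Set.image_image]; simp only [mul_assoc]⟩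

/-- A complete irredundant list of representatives computes the number of classes. -/
lemma card_quot_patternEquiv {m r : ℕ} {S : Set (Set (Equiv.Perm (Fin m)))}
    (R : Fin r → Set (Equiv.Perm (Fin m))) (hR : ∀ i, R i ∈ S)
    (hcover : ∀ s ∈ S, ∃ i, patternEquiv s (R i))
    (hinj : ∀ i j, patternEquiv (R i) (R j) → i = j) :
    Nat.card (Quot fun (s t : S) => patternEquiv s.1 t.1) = r := by
  have heq : Equivalence fun (s t : S) => patternEquiv s.1 t.1 :=
    (patternEquiv_equivalence m).comap Subtype.val
  have hbij : Function.Bijective fun i : Fin r =>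
      (Quot.mk (fun (s t : S) => patternEquiv s.1 t.1) ⟨R i, hR i⟩) := by
    refine ⟨fun i j hij => hinj i j (heq.quot_mk_eq_iff _ _ |>.1 hij), fun q => ?_⟩
    obtain ⟨⟨s, hs⟩, rfl⟩ := Quot.exists_rep q
    obtain ⟨i, hi⟩ := hcover s hs
    exact ⟨i, Quot.sound (heq.symm hi)⟩
  rw [← Nat.card_eq_of_bijective _ hbij, Nat.card_fin]

/-- A graph spanned by at most three edges is acyclic iff it contains no triangle. -/
lemma isAcyclic_fromEdgeSet_range_iff {V : Type*} {N : ℕ} (hN : N ≤ 3) (f : Fin N → Sym2 V) :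
    (SimpleGraph.fromEdgeSet (Set.range f)).IsAcyclic ↔
      ∀ a b c : V, a ≠ b → b ≠ c → c ≠ a →
        ¬ ((∃ i, f i = s(a, b)) ∧ (∃ i, f i = s(b, c)) ∧ ∃ i, f i = s(c, a)) := by
  classical
  constructor
  · rintro h a b c hab hbc hca ⟨h1, h2, h3⟩
    have e1 : (SimpleGraph.fromEdgeSet (Set.range f)).Adj a b := by
      simpa [SimpleGraph.fromEdgeSet_adj] using ⟨h1, hab⟩
    have e2 : (SimpleGraph.fromEdgeSet (Set.range f)).Adj b c := by
      simpa [SimpleGraph.fromEdgeSet_adj] using ⟨h2, hbc⟩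
    have e3 : (SimpleGraph.fromEdgeSet (Set.range f)).Adj c a := by
      simpa [SimpleGraph.fromEdgeSet_adj] using ⟨h3, hca⟩
    refine h (SimpleGraph.Walk.cons e1 (.cons e2 (.cons e3 .nil))) ?_
    rw [SimpleGraph.Walk.cons_isCycle_iff]
    simp [SimpleGraph.Walk.cons_isPath_iff]
    grind
  · intro h u p hp
    have hle : p.length ≤ N := by
      rw [← SimpleGraph.Walk.length_edges, ← List.toFinset_card_of_nodup hp.edges_nodup]
      calc p.edges.toFinset.card ≤ (Finset.univ.image f).card := by
            refine Finset.card_le_card fun e he => ?_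
            have := p.edges_subset_edgeSet (List.mem_toFinset.1 he)
            rw [SimpleGraph.edgeSet_fromEdgeSet] at this
            simpa using this.1
        _ ≤ N := Finset.card_image_le.trans (by simp)
    have hlen := hp.three_le_length
    match p, hp with
    | .nil, hp => simp at hlen
    | .cons _ .nil, hp => simp at hlen
    | .cons _ (.cons _ .nil), hp => simp at hlen
    | .cons h1 (.cons h2 (.cons h3 .nil)), hp =>
      rw [SimpleGraph.fromEdgeSet_adj] at h1 h2 h3
      exact h _ _ _ h1.2 h2.2 h3.2 ⟨h1.1, h2.1, h3.1⟩
    | .cons _ (.cons _ (.cons _ (.cons _ _))), hp =>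
      simp only [SimpleGraph.Walk.length_cons] at hle
      omega

/-- With at most two edges every simple graph is acyclic. -/
lemma isAcyclic_fromEdgeSet_range {V : Type*} {N : ℕ} (hN : N ≤ 2) (f : Fin N → Sym2 V) :
    (SimpleGraph.fromEdgeSet (Set.range f)).IsAcyclic := by
  rw [isAcyclic_fromEdgeSet_range_iff (by omega)]
  rintro a b c hab hbc hca ⟨⟨i, hi⟩, ⟨j, hj⟩, ⟨k, hk⟩⟩
  have hij : i ≠ j := by rintro rfl; rw [hi] at hj; simp at hj; grind
  have hjk : j ≠ k := by rintro rfl; rw [hj] at hk; simp at hk; grind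
  have hik : i ≠ k := by rintro rfl; rw [hi] at hk; simp at hk; grind
  omega

lemma linearIndependent_euclideanSpace_two {f : Fin 2 → EuclideanSpace ℝ (Fin 2)} :
    LinearIndependent ℝ f ↔ f 0 0 * f 1 1 - f 0 1 * f 1 0 ≠ 0 := by
  rw [← LinearMap.linearIndependent_iff (EuclideanSpace.equiv (Fin 2) ℝ).toLinearMap
    (LinearMap.ker_eq_bot.2 (EuclideanSpace.equiv (Fin 2) ℝ).injective)]
  have := Matrix.linearIndependent_rows_iff_isUnit (K := ℝ)
    (A := Matrix.of fun i j => f i j)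
  rw [Matrix.isUnit_iff_isUnit_det, isUnit_iff_ne_zero, Matrix.det_fin_two] at this
  exact this

lemma linearIndependent_euclideanSpace_one_prod {f : Fin 2 → EuclideanSpace ℝ (Fin 1) × ℝ} :
    LinearIndependent ℝ f ↔ (f 0).1 0 * (f 1).2 - (f 0).2 * (f 1).1 0 ≠ 0 := by
  let L : EuclideanSpace ℝ (Fin 1) × ℝ →ₗ[ℝ] (Fin 2 → ℝ) :=
    { toFun := fun p => ![p.1 0, p.2]
      map_add' := fun p q => by ext i; fin_cases i <;> rfl
      map_smul' := fun c p => by ext i; fin_cases i <;> rfl }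
  have hL : Function.Injective L := by
    intro p q h
    refine Prod.ext (PiLp.ext fun i => ?_) (congrFun h 1)
    rw [Subsingleton.elim i 0]
    exact congrFun h 0
  rw [← LinearMap.linearIndependent_iff L (LinearMap.ker_eq_bot.2 hL)]
  have := Matrix.linearIndependent_rows_iff_isUnit (K := ℝ) (A := Matrix.of (L ∘ f))
  rw [Matrix.isUnit_iff_isUnit_det, isUnit_iff_ne_zero, Matrix.det_fin_two] at this
  exact this

lemma linearIndependent_euclideanSpace_two_prod {f : Fin 3 → EuclideanSpace ℝ (Fin 2) × ℝ} :
    LinearIndependent ℝ f ↔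
      (Matrix.of fun i => ![(f i).1 0, (f i).1 1, (f i).2]).det ≠ 0 := by
  let L : EuclideanSpace ℝ (Fin 2) × ℝ →ₗ[ℝ] (Fin 3 → ℝ) :=
    { toFun := fun p => ![p.1 0, p.1 1, p.2]
      map_add' := fun p q => by ext i; fin_cases i <;> rfl
      map_smul' := fun c p => by ext i; fin_cases i <;> rfl }
  have hL : Function.Injective L := by
    intro p q h
    refine Prod.ext (PiLp.ext fun i => ?_) (congrFun h 2)
    fin_cases i
    · exact congrFun h 0
    · exact congrFun h 1
  rw [← LinearMap.linearIndependent_iff L (LinearMap.ker_eq_bot.2 hL)]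
  have := Matrix.linearIndependent_rows_iff_isUnit (K := ℝ) (A := Matrix.of (L ∘ f))
  rw [Matrix.isUnit_iff_isUnit_det, isUnit_iff_ne_zero] at this
  exact this

/-- The determinant of the reduced incidence matrix of three edges on `Fin 4`. -/
def edgeDet (p q r : Fin 4 × Fin 4) : ℤ :=
  let d (e : Fin 4 × Fin 4) (k : Fin 4) : ℤ :=
    (if e.1 = k then 1 else 0) - (if e.2 = k then 1 else 0)
  d p 1 * (d q 2 * d r 3 - d q 3 * d r 2) - d p 2 * (d q 1 * d r 3 - d q 3 * d r 1) +
    d p 3 * (d q 1 * d r 2 - d q 2 * d r 1)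

set_option maxRecDepth 100000 in
set_option synthInstance.maxSize 2000 in
set_option synthInstance.maxHeartbeats 400000 in
lemma edgeDet_ne_zero_iff : ∀ p q r : Fin 4 × Fin 4, p.1 ≠ p.2 → q.1 ≠ q.2 → r.1 ≠ r.2 →
    s(p.1, p.2) ≠ s(q.1, q.2) → s(p.1, p.2) ≠ s(r.1, r.2) → s(q.1, q.2) ≠ s(r.1, r.2) →
    (edgeDet p q r ≠ 0 ↔ ∀ a b c : Fin 4, a ≠ b → b ≠ c → c ≠ a →
      ¬ ((∃ i, ![s(p.1, p.2), s(q.1, q.2), s(r.1, r.2)] i = s(a, b)) ∧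
        (∃ i, ![s(p.1, p.2), s(q.1, q.2), s(r.1, r.2)] i = s(b, c)) ∧
        ∃ i, ![s(p.1, p.2), s(q.1, q.2), s(r.1, r.2)] i = s(c, a))) := by
  decide +kernel

lemma conditionA_two_iff {μ : Fin 4 → EuclideanSpace ℝ (Fin 2)} :
    ConditionA 2 μ ↔ ∀ a b c d : Fin 4, a ≠ b → c ≠ d → s(a, b) ≠ s(c, d) →
      (μ a 0 - μ b 0) * (μ c 1 - μ d 1) - (μ a 1 - μ b 1) * (μ c 0 - μ d 0) ≠ 0 := by
  constructor
  · intro h a b c d hab hcd hne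
    have := (h ![(a, b), (c, d)] (by simp [Fin.forall_fin_two, hab, hcd])
      (by
        intro i j hij
        fin_cases i <;> fin_cases j
        exacts [rfl, absurd hij hne, absurd hij.symm hne, rfl])).1
      (isAcyclic_fromEdgeSet_range le_rfl _)
    rw [linearIndependent_euclideanSpace_two] at this
    simpa using this
  · intro h e he hinj
    refine iff_of_true (isAcyclic_fromEdgeSet_range le_rfl _) ?_
    rw [linearIndependent_euclideanSpace_two]
    exact h _ _ _ _ (he 0) (he 1) (hinj.ne (by decide : (0 : Fin 2) ≠ 1))

/-- Four points of `ℝ² × ℝ` satisfy condition (A) iff they are affinely independent. -/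
lemma conditionA_three_iff {ν : Fin 4 → EuclideanSpace ℝ (Fin 2) × ℝ} :
    ConditionA 3 ν ↔ (Matrix.of fun i : Fin 3 => ![(ν i.succ - ν 0).1 0, (ν i.succ - ν 0).1 1,
      (ν i.succ - ν 0).2]).det ≠ 0 := by
  constructor
  · intro h
    have := (h (fun i => (i.succ, 0)) (by decide) (by decide)).1
      ((isAcyclic_fromEdgeSet_range_iff le_rfl _).2 (by decide))
    exact linearIndependent_euclideanSpace_two_prod.1 this
  · intro h e he hinj
    have hcomb := edgeDet_ne_zero_iff (e 0) (e 1) (e 2) (he 0) (he 1) (he 2)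
      (hinj.ne (by decide : (0 : Fin 3) ≠ 1)) (hinj.ne (by decide : (0 : Fin 3) ≠ 2))
      (hinj.ne (by decide : (1 : Fin 3) ≠ 2))
    have hvec : ![s((e 0).1, (e 0).2), s((e 1).1, (e 1).2), s((e 2).1, (e 2).2)] =
        fun k => s((e k).1, (e k).2) := by
      ext k; fin_cases k <;> rfl
    rw [hvec] at hcomb
    rw [isAcyclic_fromEdgeSet_range_iff le_rfl, ← hcomb,
      linearIndependent_euclideanSpace_two_prod]
    let d (e : Fin 4 × Fin 4) (k : Fin 4) : ℤ :=
      (if e.1 = k then 1 else 0) - (if e.2 = k then 1 else 0)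
    have hdiff : ∀ (x : Fin 4 → ℝ) (p : Fin 4 × Fin 4), x p.1 - x p.2 =
        d p 1 * (x 1 - x 0) + d p 2 * (x 2 - x 0) + d p 3 * (x 3 - x 0) := by
      rintro x ⟨a, b⟩
      fin_cases a <;> fin_cases b <;> simp [d]
    have h0 := hdiff fun i => (ν i).1 0
    have h1 := hdiff fun i => (ν i).1 1
    have h2 := hdiff fun i => (ν i).2
    have hdet : (Matrix.of fun i => ![(ν (e i).1 - ν (e i).2).1 0, (ν (e i).1 - ν (e i).2).1 1,
          (ν (e i).1 - ν (e i).2).2]).det =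
        (edgeDet (e 0) (e 1) (e 2) : ℝ) * (Matrix.of fun i : Fin 3 =>
          ![(ν i.succ - ν 0).1 0, (ν i.succ - ν 0).1 1, (ν i.succ - ν 0).2]).det := by
      have hE : edgeDet (e 0) (e 1) (e 2) =
          d (e 0) 1 * (d (e 1) 2 * d (e 2) 3 - d (e 1) 3 * d (e 2) 2) -
          d (e 0) 2 * (d (e 1) 1 * d (e 2) 3 - d (e 1) 3 * d (e 2) 1) +
          d (e 0) 3 * (d (e 1) 1 * d (e 2) 2 - d (e 1) 2 * d (e 2) 1) := rfl
      rw [hE, Matrix.det_fin_three, Matrix.det_fin_three]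
      simp [h0, h1, h2]
      ring
    rw [hdet, mul_ne_zero_iff, Int.cast_ne_zero]
    exact ⟨fun hne => ⟨hne, h⟩, And.left⟩

lemma conditionA_one_iff {μ : Fin 3 → EuclideanSpace ℝ (Fin 1)} :
    ConditionA 1 μ ↔ ∀ a b : Fin 3, a ≠ b → μ a 0 ≠ μ b 0 := by
  have key : ∀ a b, μ a - μ b ≠ 0 ↔ μ a 0 ≠ μ b 0 := by
    intro a b
    rw [sub_ne_zero, not_iff_not]
    refine ⟨fun h => by rw [h], fun h => PiLp.ext fun i => ?_⟩
    rwa [Subsingleton.elim i 0]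
  constructor
  · intro h a b hab
    have := (h (fun _ => (a, b)) (fun _ => hab) (Function.injective_of_subsingleton _)).1
      (isAcyclic_fromEdgeSet_range (by norm_num) _)
    rw [linearIndependent_unique_iff] at this
    exact (key a b).1 this
  · intro h e he _
    refine iff_of_true (isAcyclic_fromEdgeSet_range (by norm_num) _) ?_
    rw [linearIndependent_unique_iff]
    exact (key _ _).2 (h _ _ (he _))

lemma conditionA_two_lift {μ : Fin 3 → EuclideanSpace ℝ (Fin 1)}
    (h : ∀ a b : Fin 3, a ≠ b → μ a 0 ≠ μ b 0) :
    ConditionA 2 (fun j => (μ j, ‖μ j‖ ^ 2) : Fin 3 → EuclideanSpace ℝ (Fin 1) × ℝ) := by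
  intro e he hinj
  refine iff_of_true (isAcyclic_fromEdgeSet_range le_rfl _) ?_
  rw [linearIndependent_euclideanSpace_one_prod]
  have hn : ∀ j, ‖μ j‖ ^ 2 = μ j 0 ^ 2 := by simp [EuclideanSpace.norm_sq_eq]
  have hne : s((e 0).1, (e 0).2) ≠ s((e 1).1, (e 1).2) :=
    hinj.ne (by decide : (0 : Fin 2) ≠ 1)
  have hsum : ∀ a b c d : Fin 3, a ≠ b → c ≠ d → s(a, b) ≠ s(c, d) →
      μ a 0 + μ b 0 ≠ μ c 0 + μ d 0 := by
    intro a b c d hab hcd hne heq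
    have : a = c ∨ a = d ∨ b = c ∨ b = d := by omega
    rcases this with rfl | rfl | rfl | rfl
    · exact h b d (by rintro rfl; exact hne rfl) (by linarith)
    · exact h b c (by rintro rfl; exact hne Sym2.eq_swap) (by linarith)
    · exact h a d (by rintro rfl; exact hne Sym2.eq_swap) (by linarith)
    · exact h a c (by rintro rfl; exact hne rfl) (by linarith)
  have hprod := mul_ne_zero
    (mul_ne_zero (sub_ne_zero.2 (h _ _ (he 0))) (sub_ne_zero.2 (h _ _ (he 1))))
    (sub_ne_zero.2 (hsum _ _ _ _ (he 1) (he 0) hne.symm))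
  simp only [hn, Prod.fst_sub, Prod.snd_sub, PiLp.sub_apply]
  convert hprod using 1
  ring

lemma generic_three_iff {μ : Fin 3 → EuclideanSpace ℝ (Fin 1)} :
    Generic (m := 3) μ ↔ ∀ a b : Fin 3, a ≠ b → μ a 0 ≠ μ b 0 :=
  ⟨fun h => conditionA_one_iff.1 h.1, fun h => ⟨conditionA_one_iff.2 h, conditionA_two_lift h⟩⟩

lemma generic_four_iff {μ : Fin 4 → EuclideanSpace ℝ (Fin 2)} :
    Generic (m := 4) μ ↔
      (∀ a b c d : Fin 4, a ≠ b → c ≠ d → s(a, b) ≠ s(c, d) →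
        (μ a 0 - μ b 0) * (μ c 1 - μ d 1) - (μ a 1 - μ b 1) * (μ c 0 - μ d 0) ≠ 0) ∧
      (Matrix.of fun i : Fin 3 => ![μ i.succ 0 - μ 0 0, μ i.succ 1 - μ 0 1,
        ‖μ i.succ‖ ^ 2 - ‖μ 0‖ ^ 2]).det ≠ 0 :=
  and_congr conditionA_two_iff conditionA_three_iff

/-- In the plane, the affine functions restrict to the solutions of a nondegenerate dependency. -/
lemma exists_affine_of_dependency_four {μ : Fin 4 → EuclideanSpace ℝ (Fin 2)} {v : Fin 4 → ℝ}
    (hv : ∑ i, v i = 0) (hμ : ∑ i, v i • μ i = 0) (hv3 : v 3 ≠ 0)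
    (hdet : (μ 1 0 - μ 0 0) * (μ 2 1 - μ 0 1) - (μ 1 1 - μ 0 1) * (μ 2 0 - μ 0 0) ≠ 0)
    (z : Fin 4 → ℝ) (hz : ∑ i, v i * z i = 0) :
    ∃ (y : EuclideanSpace ℝ (Fin 2)) (t : ℝ), ∀ i, z i = inner ℝ y (μ i) + t := by
  set D := (μ 1 0 - μ 0 0) * (μ 2 1 - μ 0 1) - (μ 1 1 - μ 0 1) * (μ 2 0 - μ 0 0) with hD
  set p := ((z 1 - z 0) * (μ 2 1 - μ 0 1) - (μ 1 1 - μ 0 1) * (z 2 - z 0)) / D with hp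
  set q := ((μ 1 0 - μ 0 0) * (z 2 - z 0) - (z 1 - z 0) * (μ 2 0 - μ 0 0)) / D with hq
  have hx : ∑ i, v i * μ i 0 = 0 := by simpa using congrArg (fun u => u 0) hμ
  have hy : ∑ i, v i * μ i 1 = 0 := by simpa using congrArg (fun u => u 1) hμ
  have h1 : z 1 - z 0 = p * (μ 1 0 - μ 0 0) + q * (μ 1 1 - μ 0 1) := by
    rw [hp, hq]; field_simp; rw [hD]; ring
  have h2 : z 2 - z 0 = p * (μ 2 0 - μ 0 0) + q * (μ 2 1 - μ 0 1) := by
    rw [hp, hq]; field_simp; rw [hD]; ring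
  rw [Fin.sum_univ_four] at hv hz hx hy
  have h3 : z 3 - z 0 = p * (μ 3 0 - μ 0 0) + q * (μ 3 1 - μ 0 1) := by
    apply mul_left_cancel₀ hv3
    linear_combination hz - v 1 * h1 - v 2 * h2 - z 0 * hv - p * hx - q * hy +
      (p * μ 0 0 + q * μ 0 1) * hv
  refine ⟨!₂[p, q], z 0 - p * μ 0 0 - q * μ 0 1, fun i => ?_⟩
  simp only [PiLp.inner_apply, Fin.sum_univ_two]
  fin_cases i <;> simp <;> linarith

lemma exists_affine_of_dependency_three {μ : Fin 3 → EuclideanSpace ℝ (Fin 1)} {v : Fin 3 → ℝ}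
    (hv : ∑ i, v i = 0) (hμ : ∑ i, v i • μ i = 0) (hv2 : v 2 ≠ 0) (hne : μ 1 0 - μ 0 0 ≠ 0)
    (z : Fin 3 → ℝ) (hz : ∑ i, v i * z i = 0) :
    ∃ (y : EuclideanSpace ℝ (Fin 1)) (t : ℝ), ∀ i, z i = inner ℝ y (μ i) + t := by
  set p := (z 1 - z 0) / (μ 1 0 - μ 0 0) with hp
  have hx : ∑ i, v i * μ i 0 = 0 := by simpa using congrArg (fun u => u 0) hμ
  have h1 : z 1 - z 0 = p * (μ 1 0 - μ 0 0) := by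
    rw [hp]; field_simp
  rw [Fin.sum_univ_three] at hv hz hx
  have h2 : z 2 - z 0 = p * (μ 2 0 - μ 0 0) := by
    apply mul_left_cancel₀ hv2
    linear_combination hz - v 1 * h1 - z 0 * hv - p * hx + p * μ 0 0 * hv
  refine ⟨!₂[p], z 0 - p * μ 0 0, fun i => ?_⟩
  simp only [PiLp.inner_apply, Fin.sum_univ_one]
  fin_cases i <;> simp <;> linarith

/-- A generic planar configuration has the sign pattern of an affine dependency, all of whose
proper subset sums are nonzero. -/
lemma exists_signPattern_four {μ : Fin 4 → EuclideanSpace ℝ (Fin 2)} (hG : Generic (m := 4) μ) :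
    ∃ v : Fin 4 → ℝ, ∑ i, v i = 0 ∧ (∀ i, v i ≠ 0) ∧ (∀ i j, i ≠ j → v i + v j ≠ 0) ∧
      (∀ j, ∃ i ≠ j, v i < 0) ∧ rankingPatternUF μ = signPattern v := by
  obtain ⟨h2, h3⟩ := generic_four_iff.1 hG
  obtain ⟨v, hv0, hv1, hv2, hv3⟩ : ∃ v : Fin 4 → ℝ,
      v 0 = (μ 2 0 - μ 1 0) * (μ 3 1 - μ 1 1) - (μ 2 1 - μ 1 1) * (μ 3 0 - μ 1 0) ∧
      v 1 = -((μ 2 0 - μ 0 0) * (μ 3 1 - μ 0 1) - (μ 2 1 - μ 0 1) * (μ 3 0 - μ 0 0)) ∧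
      v 2 = (μ 1 0 - μ 0 0) * (μ 3 1 - μ 0 1) - (μ 1 1 - μ 0 1) * (μ 3 0 - μ 0 0) ∧
      v 3 = -((μ 1 0 - μ 0 0) * (μ 2 1 - μ 0 1) - (μ 1 1 - μ 0 1) * (μ 2 0 - μ 0 0)) :=
    ⟨![_, _, _, _], rfl, rfl, rfl, rfl⟩
  have hsum : ∑ i, v i = 0 := by
    rw [Fin.sum_univ_four, hv0, hv1, hv2, hv3]; ring
  have hμ : ∑ i, v i • μ i = 0 := by
    ext k
    rw [Fin.sum_univ_four, hv0, hv1, hv2, hv3]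
    fin_cases k <;> simp <;> ring
  have hQ : ∑ i, v i * ‖μ i‖ ^ 2 ≠ 0 := by
    have : ∑ i, v i * ‖μ i‖ ^ 2 = -(Matrix.of fun i : Fin 3 => ![μ i.succ 0 - μ 0 0,
        μ i.succ 1 - μ 0 1, ‖μ i.succ‖ ^ 2 - ‖μ 0‖ ^ 2]).det := by
      rw [Fin.sum_univ_four, hv0, hv1, hv2, hv3, Matrix.det_fin_three]
      simp
      ring
    rw [this]
    exact neg_ne_zero.2 h3
  have hne : ∀ i, v i ≠ 0 := by
    have e0 := h2 2 1 3 1 (by decide) (by decide) (by decide)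
    have e1 := h2 2 0 3 0 (by decide) (by decide) (by decide)
    have e2 := h2 1 0 3 0 (by decide) (by decide) (by decide)
    have e3 := h2 1 0 2 0 (by decide) (by decide) (by decide)
    intro i
    fin_cases i
    · simpa only [Fin.zero_eta, hv0] using e0
    · simpa only [Fin.mk_one, hv1] using neg_ne_zero.2 e1
    · simpa only [Fin.reduceFinMk, hv2] using e2
    · simpa only [Fin.reduceFinMk, hv3] using neg_ne_zero.2 e3
  have hpair : ∀ i j, i ≠ j → v i + v j ≠ 0 := by
    have e01 := h2 0 1 2 3 (by decide) (by decide) (by decide)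
    have e02 := h2 0 2 1 3 (by decide) (by decide) (by decide)
    have e03 := h2 0 3 1 2 (by decide) (by decide) (by decide)
    have p01 : v 0 + v 1 ≠ 0 := fun h => e01 (by rw [hv0, hv1] at h; linarith)
    have p02 : v 0 + v 2 ≠ 0 := fun h => e02 (by rw [hv0, hv2] at h; linarith)
    have p03 : v 0 + v 3 ≠ 0 := fun h => e03 (by rw [hv0, hv3] at h; linarith)
    rw [Fin.sum_univ_four] at hsum
    intro i j hij h
    fin_cases i <;> fin_cases j <;> simp only [Fin.zero_eta, Fin.mk_one, Fin.reduceFinMk] at h <;>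
      first
        | exact hij rfl
        | exact p01 (by linarith)
        | exact p02 (by linarith)
        | exact p03 (by linarith)
  obtain ⟨c, hc, hcQ⟩ : ∃ c : ℝ, c ≠ 0 ∧ c * ∑ i, v i * ‖μ i‖ ^ 2 < 0 :=
    ⟨-∑ i, v i * ‖μ i‖ ^ 2, neg_ne_zero.2 hQ, by nlinarith [mul_self_pos.2 hQ]⟩
  have hsum' : ∑ i, c * v i = 0 := by rw [← Finset.mul_sum, hsum, mul_zero]
  have hμ' : ∑ i, (c * v i) • μ i = 0 := by
    simp only [mul_smul]
    rw [← Finset.smul_sum, hμ, smul_zero]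
  have hQ' : ∑ i, (c * v i) * ‖μ i‖ ^ 2 < 0 := by
    simpa only [Finset.mul_sum, mul_assoc] using hcQ
  refine ⟨fun i => c * v i, hsum', fun i => mul_ne_zero hc (hne i), fun i j hij => ?_,
    exists_ne_neg_of_sum_mul_norm_sq_neg hsum' hμ' hQ',
    rankingPatternUF_eq_signPattern hsum' hμ' hQ'
      (exists_affine_of_dependency_four hsum' hμ' (mul_ne_zero hc (hne 3)) ?_)⟩
  · rw [← mul_add]
    exact mul_ne_zero hc (hpair i j hij)
  · exact h2 1 0 2 0 (by decide) (by decide) (by decide)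

lemma exists_signPattern_three {μ : Fin 3 → EuclideanSpace ℝ (Fin 1)}
    (hG : Generic (m := 3) μ) :
    ∃ v : Fin 3 → ℝ, ∑ i, v i = 0 ∧ (∀ j, ∃ i ≠ j, v i < 0) ∧
      rankingPatternUF μ = signPattern v := by
  have h := generic_three_iff.1 hG
  have h01 := sub_ne_zero.2 (h 0 1 (by decide))
  have h12 := sub_ne_zero.2 (h 1 2 (by decide))
  have h20 := sub_ne_zero.2 (h 2 0 (by decide))
  obtain ⟨c, hc, hcQ⟩ : ∃ c : ℝ, c ≠ 0 ∧
      c * ((μ 0 0 - μ 1 0) * (μ 1 0 - μ 2 0) * (μ 2 0 - μ 0 0)) < 0 :=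
    ⟨-((μ 0 0 - μ 1 0) * (μ 1 0 - μ 2 0) * (μ 2 0 - μ 0 0)),
      neg_ne_zero.2 (mul_ne_zero (mul_ne_zero h01 h12) h20),
      by nlinarith [mul_self_pos.2 (mul_ne_zero (mul_ne_zero h01 h12) h20)]⟩
  obtain ⟨v, hv0, hv1, hv2⟩ : ∃ v : Fin 3 → ℝ, v 0 = -c * (μ 1 0 - μ 2 0) ∧
      v 1 = -c * (μ 2 0 - μ 0 0) ∧ v 2 = -c * (μ 0 0 - μ 1 0) :=
    ⟨![_, _, _], rfl, rfl, rfl⟩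
  have hsum : ∑ i, v i = 0 := by
    rw [Fin.sum_univ_three, hv0, hv1, hv2]; ring
  have hμ : ∑ i, v i • μ i = 0 := by
    ext k
    rw [Fin.sum_univ_three, hv0, hv1, hv2, Subsingleton.elim k 0]
    simp
    ring
  have hQ : ∑ i, v i * ‖μ i‖ ^ 2 < 0 := by
    have hn : ∀ j, ‖μ j‖ ^ 2 = μ j 0 ^ 2 := by simp [EuclideanSpace.norm_sq_eq]
    rw [Fin.sum_univ_three, hv0, hv1, hv2, hn, hn, hn]
    linarith
  have hv2' : v 2 ≠ 0 := hv2 ▸ mul_ne_zero (neg_ne_zero.2 hc) h01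
  exact ⟨v, hsum, exists_ne_neg_of_sum_mul_norm_sq_neg hsum hμ hQ,
    rankingPatternUF_eq_signPattern hsum hμ hQ
      (exists_affine_of_dependency_three hsum hμ hv2' (sub_ne_zero.2 (h 1 0 (by decide))))⟩

lemma exists_perm_antitone_comp {m : ℕ} (v : Fin m → ℝ) :
    ∃ σ : Equiv.Perm (Fin m), Antitone (v ∘ σ) :=
  ⟨Tuple.sort (-v), fun _ _ hij => neg_le_neg_iff.1 (Tuple.monotone_sort (-v) hij)⟩

/-- Representatives, up to relabelling, of the affine dependencies of generic planar
four-point configurations: a triangle with an interior point, and two convex quadrilaterals. -/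
def dependencyFour : Fin 3 → Fin 4 → ℤ :=
  ![![3, -1, -1, -1], ![4, 1, -2, -3], ![3, 2, -1, -4]]

/-- The coordinates of configurations realizing `dependencyFour`. -/
def configurationFour : Fin 3 → Fin 4 → Fin 2 → ℤ :=
  ![![![0, 0], ![1, 0], ![0, 1], ![-1, -1]], ![![1, 0], ![4, 2], ![4, 1], ![0, 0]],
    ![![1, 0], ![0, 1], ![3, 2], ![0, 0]]]

lemma signPattern_dependencyFour_mem (r : Fin 3) :
    signPattern (dependencyFour r) ∈ rankingPatternsUF 4 := by
  set μ : Fin 4 → EuclideanSpace ℝ (Fin 2) :=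
    fun i => WithLp.toLp 2 fun k => (configurationFour r i k : ℝ) with hμ
  have hcoord : ∀ i k, μ i k = (configurationFour r i k : ℝ) := fun _ _ => rfl
  have hplane : ∀ (r : Fin 3) (a b c d : Fin 4), a ≠ b → c ≠ d → s(a, b) ≠ s(c, d) →
      (configurationFour r a 0 - configurationFour r b 0) *
        (configurationFour r c 1 - configurationFour r d 1) -
      (configurationFour r a 1 - configurationFour r b 1) *
        (configurationFour r c 0 - configurationFour r d 0) ≠ 0 := by
    decide +kernel
  have h2 : ∀ a b c d : Fin 4, a ≠ b → c ≠ d → s(a, b) ≠ s(c, d) →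
      (μ a 0 - μ b 0) * (μ c 1 - μ d 1) - (μ a 1 - μ b 1) * (μ c 0 - μ d 0) ≠ 0 := by
    intro a b c d hab hcd hne
    simp only [hcoord]
    exact_mod_cast hplane r a b c d hab hcd hne
  have hn : ∀ i, ‖μ i‖ ^ 2 = (configurationFour r i 0 : ℝ) ^ 2 + (configurationFour r i 1) ^ 2 := by
    intro i
    simp [EuclideanSpace.norm_sq_eq, Fin.sum_univ_two, hcoord]
  refine ⟨μ, generic_four_iff.2 ⟨h2, ?_⟩, ?_⟩
  · rw [Matrix.det_fin_three]
    simp only [hn, hcoord]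
    fin_cases r <;> simp [configurationFour] <;> norm_num
  · rw [← signPattern_intCast]
    have hsum : ∑ i, (dependencyFour r i : ℝ) = 0 := by
      rw [Fin.sum_univ_four]
      fin_cases r <;> simp [dependencyFour] <;> norm_num
    have hdep : ∑ i, (dependencyFour r i : ℝ) • μ i = 0 := by
      ext k
      rw [Fin.sum_univ_four]
      simp only [PiLp.add_apply, PiLp.smul_apply, hcoord]
      fin_cases r <;> fin_cases k <;> (simp [dependencyFour, configurationFour]; try norm_num)
    refine (rankingPatternUF_eq_signPattern hsum hdep ?_
      (exists_affine_of_dependency_four hsum hdep ?_ ?_)).symm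
    · simp only [Fin.sum_univ_four, hn]
      fin_cases r <;> simp [dependencyFour, configurationFour] <;> norm_num
    · fin_cases r <;> simp [dependencyFour]
    · exact h2 1 0 2 0 (by decide) (by decide) (by decide)

/-- Up to relabelling, every dependency with two negative coefficients and nonzero proper subset
sums has the sign pattern of one of the representatives. -/
lemma exists_patternEquiv_dependencyFour {v : Fin 4 → ℝ} (hsum : ∑ i, v i = 0)
    (hne : ∀ i, v i ≠ 0) (hpair : ∀ i j, i ≠ j → v i + v j ≠ 0) (hneg : ∀ j, ∃ i ≠ j, v i < 0) :
    ∃ r, patternEquiv (signPattern v) (signPattern (dependencyFour r)) := by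
  obtain ⟨σ, hσ⟩ := exists_perm_antitone_comp v
  set w := v ∘ σ with hw
  have hwsum : w 0 + w 1 + w 2 + w 3 = 0 := by
    rw [← Fin.sum_univ_four, ← hsum]
    exact Equiv.sum_comp σ v
  have h01 : w 1 ≤ w 0 := hσ (by decide)
  have h12 : w 2 ≤ w 1 := hσ (by decide)
  have h23 : w 3 ≤ w 2 := hσ (by decide)
  have hw2 : w 2 < 0 := by
    obtain ⟨i, hi, hlt⟩ := hneg (σ 3)
    have hle : σ.symm i ≤ 2 := by
      have : σ.symm i ≠ 3 := fun h => hi (by rw [← h, Equiv.apply_symm_apply])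
      omega
    have := hσ hle
    simp only [hw, Function.comp_apply, Equiv.apply_symm_apply] at this
    exact this.trans_lt hlt
  have hw1 : w 1 ≠ 0 := hne _
  have hw02 : w 0 + w 2 ≠ 0 := hpair _ _ (σ.injective.ne (by decide))
  have hw03 : w 0 + w 3 ≠ 0 := hpair _ _ (σ.injective.ne (by decide))
  suffices h : ∃ r, signPattern w = signPattern fun i => (dependencyFour r i : ℝ) by
    obtain ⟨r, hr⟩ := h
    refine ⟨r, ?_⟩
    rw [← signPattern_intCast, ← hr]
    exact patternEquiv_signPattern_comp v σ
  rcases hw1.lt_or_gt with hw1 | hw1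
  · refine ⟨0, signPattern_congr fun I => ?_⟩
    simp only [Fin.sum_univ_four, dependencyFour, Matrix.cons_val]
    push_cast
    split_ifs <;> constructor <;> intro <;> linarith
  have hw02 : 0 < w 0 + w 2 := lt_of_le_of_ne (by linarith) hw02.symm
  rcases hw03.lt_or_gt with hw03 | hw03
  · refine ⟨2, signPattern_congr fun I => ?_⟩
    simp only [Fin.sum_univ_four, dependencyFour, Matrix.cons_val]
    push_cast
    split_ifs <;> constructor <;> intro <;> linarith
  · refine ⟨1, signPattern_congr fun I => ?_⟩
    simp only [Fin.sum_univ_four, dependencyFour, Matrix.cons_val]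
    push_cast
    split_ifs <;> constructor <;> intro <;> linarith

instance {m : ℕ} (w : Fin m → ℤ) (σ : Equiv.Perm (Fin m)) : Decidable (σ ∈ signPattern w) :=
  inferInstanceAs (Decidable (∃ k, 0 < ∑ j, if j ≤ k then w (σ j) else 0))

/-- Whether some object occupies a position of `K` only in rankings belonging to `R` is
preserved by relabelling. -/
lemma patternEquiv.exists_forall_position {m : ℕ} {R R' : Set (Equiv.Perm (Fin m))}
    (h : patternEquiv R R') (K : Finset (Fin m))
    (hR' : ∃ i, ∀ τ : Equiv.Perm (Fin m), (∃ k ∈ K, τ k = i) → τ ∈ R') :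
    ∃ i, ∀ τ : Equiv.Perm (Fin m), (∃ k ∈ K, τ k = i) → τ ∈ R := by
  obtain ⟨σ, rfl⟩ := h
  obtain ⟨i, hi⟩ := hR'
  refine ⟨σ i, fun τ ⟨k, hk, hki⟩ => ⟨σ⁻¹ * τ, hi _ ⟨k, hk, ?_⟩, by simp⟩⟩
  simp [hki]

lemma dependencyFour_position_three : ∀ r, (∃ i, ∀ τ : Equiv.Perm (Fin 4),
    (∃ k ∈ ({0, 1, 2} : Finset (Fin 4)), τ k = i) → τ ∈ signPattern (dependencyFour r)) ↔
      r = 0 := by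
  decide +kernel

lemma dependencyFour_position_two : ∀ r, (∃ i, ∀ τ : Equiv.Perm (Fin 4),
    (∃ k ∈ ({0, 1} : Finset (Fin 4)), τ k = i) → τ ∈ signPattern (dependencyFour r)) ↔
      r ≠ 2 := by
  decide +kernel

lemma dependencyFour_injective_of_patternEquiv {r s : Fin 3}
    (h : patternEquiv (signPattern (dependencyFour r)) (signPattern (dependencyFour s))) :
    r = s := by
  have h' := (patternEquiv_equivalence 4).symm h
  have h1 := h.exists_forall_position {0, 1, 2}
  have h2 := h'.exists_forall_position {0, 1, 2}
  have h3 := h.exists_forall_position {0, 1}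
  have h4 := h'.exists_forall_position {0, 1}
  rw [dependencyFour_position_three, dependencyFour_position_three] at h1 h2
  rw [dependencyFour_position_two, dependencyFour_position_two] at h3 h4
  omega

/-- The sign pattern of the affine dependency of three points on a line. -/
lemma signPattern_three_mem : signPattern (![2, -1, -1] : Fin 3 → ℝ) ∈ rankingPatternsUF 3 := by
  let μ : Fin 3 → EuclideanSpace ℝ (Fin 1) := ![!₂[0], !₂[1], !₂[-1]]
  have hG : ∀ a b : Fin 3, a ≠ b → μ a 0 ≠ μ b 0 := by
    intro a b hab
    fin_cases a <;> fin_cases b <;> first | exact absurd rfl hab | norm_num [μ]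
  have hsum : ∑ i, (![2, -1, -1] : Fin 3 → ℝ) i = 0 := by
    simp [Fin.sum_univ_three]; norm_num
  have hdep : ∑ i, (![2, -1, -1] : Fin 3 → ℝ) i • μ i = 0 := by
    ext k
    rw [Fin.sum_univ_three, Subsingleton.elim k 0]
    simp [μ]
  refine ⟨μ, generic_three_iff.2 hG, (rankingPatternUF_eq_signPattern hsum hdep ?_
    (exists_affine_of_dependency_three hsum hdep ?_ ?_)).symm⟩
  · simp [Fin.sum_univ_three, EuclideanSpace.norm_sq_eq, μ]
  · simp
  · exact sub_ne_zero.2 (hG 1 0 (by decide))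

lemma patternEquiv_signPattern_three {v : Fin 3 → ℝ} (hsum : ∑ i, v i = 0)
    (hneg : ∀ j, ∃ i ≠ j, v i < 0) :
    patternEquiv (signPattern v) (signPattern (![2, -1, -1] : Fin 3 → ℝ)) := by
  obtain ⟨σ, hσ⟩ := exists_perm_antitone_comp v
  set w := v ∘ σ with hw
  have hwsum : w 0 + w 1 + w 2 = 0 := by
    rw [← Fin.sum_univ_three, ← hsum]
    exact Equiv.sum_comp σ v
  have h12 : w 2 ≤ w 1 := hσ (by decide)
  have hw1 : w 1 < 0 := by
    obtain ⟨i, hi, hlt⟩ := hneg (σ 2)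
    have hle : σ.symm i ≤ 1 := by
      have : σ.symm i ≠ 2 := fun h => hi (by rw [← h, Equiv.apply_symm_apply])
      omega
    have := hσ hle
    simp only [hw, Function.comp_apply, Equiv.apply_symm_apply] at this
    exact this.trans_lt hlt
  have heq : signPattern w = signPattern (![2, -1, -1] : Fin 3 → ℝ) := by
    refine signPattern_congr fun I => ?_
    simp only [Fin.sum_univ_three, Matrix.cons_val]
    split_ifs <;> constructor <;> intro <;> linarith
  rw [← heq]
  exact patternEquiv_signPattern_comp v σ

/-- For `m = 3` there is exactly `1` inequivalent ranking pattern of unfolding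
models of codimension one, and for `m = 4` there are exactly `3`. -/
theorem card_inequiv_rankingPatternsUF_three_four :
    Nat.card (Quot fun (R R' : rankingPatternsUF 3) => patternEquiv R.1 R'.1) = 1 ∧
      Nat.card (Quot fun (R R' : rankingPatternsUF 4) => patternEquiv R.1 R'.1) = 3 := by
  refine ⟨card_quot_patternEquiv (fun _ : Fin 1 => signPattern (![2, -1, -1] : Fin 3 → ℝ))
      (fun _ => signPattern_three_mem) ?_ fun _ _ _ => Subsingleton.elim _ _,
    card_quot_patternEquiv (fun r => signPattern (dependencyFour r))
      signPattern_dependencyFour_mem ?_ fun _ _ => dependencyFour_injective_of_patternEquiv⟩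
  · rintro _ ⟨μ, hG, rfl⟩
    obtain ⟨v, hsum, hneg, heq⟩ := exists_signPattern_three hG
    exact ⟨0, heq ▸ patternEquiv_signPattern_three hsum hneg⟩
  · rintro _ ⟨μ, hG, rfl⟩
    obtain ⟨v, hsum, hne, hpair, hneg, heq⟩ := exists_signPattern_four hG
    exact heq ▸ exists_patternEquiv_dependencyFour hsum hne hpair hneg
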